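/- arXiv:2110.08137 — 9 statements merged into one kernel-verified Lean document; each statement's English description precedes it below -/
import Mathlib

section
/- Consider the non-jacketed CSTR operating at constant concentration: c(t) = c⁰ for all t with 0 < c⁰ < 1. If T : ℝ → ℝ is differentiable with T(t) > 0 for all t and the concentration equation c' = (1 - c)·ρ/V - c·k·exp(-N/T) holds for all t, then the production rate is determined by the temperature: ρ(t) = V·c⁰·k·exp(-N/T(t))/(1 - c⁰) for all t; consequently ρ is differentiable with ρ'(t) = N·ρ(t)·T'(t)/T(t)². -/
/-- Non-jacketed CSTR at constant concentration: the production rate is determined by the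
temperature, `ρ = V·c⁰·k·exp(-N/T)/(1-c⁰)`, and is differentiable with
`ρ' = N·ρ·T'/T²`. -/
theorem cstr1_const_conc_production_rate
    (V k N αc Tf Tc : ℝ) (hV : 0 < V) (hk : 0 < k) (hN : 0 < N) (hαc : 0 < αc)
    (c0 : ℝ) (hc0 : 0 < c0) (hc0' : c0 < 1)
    (c T ρ : ℝ → ℝ)
    (hconst : ∀ t, c t = c0)
    (hT : Differentiable ℝ T) (hTpos : ∀ t, 0 < T t)
    (eq1 : ∀ t, deriv c t = (1 - c t) * ρ t / V - c t * k * Real.exp (-N / T t)) :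
    (∀ t, ρ t = V * c0 * k * Real.exp (-N / T t) / (1 - c0)) ∧
      Differentiable ℝ ρ ∧
      ∀ t, deriv ρ t = N * ρ t * deriv T t / (T t) ^ 2 := by
  have hc : c = fun _ => c0 := funext hconst
  have h1 : 1 - c0 ≠ 0 := (sub_pos.mpr hc0').ne'
  have hρ : ∀ t, ρ t = V * c0 * k * Real.exp (-N / T t) / (1 - c0) := by
    intro t
    have h := eq1 t
    rw [hc, deriv_const] at h
    have h2 : (1 - c0) * ρ t / V = c0 * k * Real.exp (-N / T t) := (sub_eq_zero.mp h.symm)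
    rw [div_eq_iff hV.ne'] at h2
    rw [eq_div_iff h1]
    linarith
  have hd : ∀ t, HasDerivAt ρ (N * ρ t * deriv T t / (T t) ^ 2) t := by
    intro t
    have hTt : T t ≠ 0 := (hTpos t).ne'
    have h := ((((hasDerivAt_const t (-N)).div (hT t).hasDerivAt hTt).exp).const_mul
      (V * c0 * k)).div_const (1 - c0)
    rw [hρ t, funext hρ]
    refine h.congr_deriv ?_
    simp only [Pi.div_apply]
    ring
  exact ⟨hρ, fun t => (hd t).differentiableAt, fun t => (hd t).deriv⟩
end

section
/- Consider the non-jacketed CSTR operating at constant concentration c(t) = c⁰ for all t, with 0 < c⁰ < 1. Let T : ℝ → ℝ be differentiable with T(t) > 0 for all t, let ρ, F_c : ℝ → ℝ, and suppose both model equations hold for all t. Then ρ is differentiable and for every t, ρ'(t) = (N·ρ(t)/T(t)²)·((T_f - T(t))·ρ(t)/V + ρ(t)·(1 - c⁰)/V - F_c(t)·α_c·(T(t) - T_c)). -/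
/-- Non-jacketed CSTR at constant concentration: the production rate is differentiable
and `ρ' = (N·ρ/T²)·((T_f-T)·ρ/V + ρ·(1-c⁰)/V - F_c·α_c·(T-T_c))`. -/
theorem cstr1_const_conc_rho_derivative
    (V k N αc Tf Tc : ℝ) (hV : 0 < V) (hk : 0 < k) (hN : 0 < N) (hαc : 0 < αc)
    (c0 : ℝ) (hc0 : 0 < c0) (hc0' : c0 < 1)
    (c T ρ Fc : ℝ → ℝ)
    (hconst : ∀ t, c t = c0)
    (hT : Differentiable ℝ T) (hTpos : ∀ t, 0 < T t)
    (eq1 : ∀ t, deriv c t = (1 - c t) * ρ t / V - c t * k * Real.exp (-N / T t))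
    (eq2 : ∀ t, deriv T t =
      (Tf - T t) * ρ t / V + c t * k * Real.exp (-N / T t) - Fc t * αc * (T t - Tc)) :
    Differentiable ℝ ρ ∧
      ∀ t, deriv ρ t = (N * ρ t / (T t) ^ 2) *
        ((Tf - T t) * ρ t / V + ρ t * (1 - c0) / V - Fc t * αc * (T t - Tc)) := by
  have hc : deriv c = 0 := by
    rw [funext hconst]
    exact deriv_const' c0
  have h1 : 1 - c0 ≠ 0 := (sub_pos.mpr hc0').ne'
  have balance : ∀ t, c0 * k * Real.exp (-N / T t) = ρ t * (1 - c0) / V := by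
    intro t
    have h := eq1 t
    rw [hc, hconst, Pi.zero_apply] at h
    linear_combination h
  have hρ : ρ = fun t => V * c0 * k / (1 - c0) * Real.exp (-N / T t) := by
    funext t
    have h := balance t
    field_simp at h ⊢
    linear_combination -h
  have hderiv : ∀ t, HasDerivAt ρ (N * ρ t / (T t) ^ 2 * deriv T t) t := by
    intro t
    have hexp := (((hasDerivAt_const t (-N)).div (hT t).hasDerivAt (hTpos t).ne').exp).const_mul
      (V * c0 * k / (1 - c0))
    rw [hρ]
    refine hexp.congr_deriv ?_
    simp only [Pi.div_apply]
    ring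
  refine ⟨fun t => (hderiv t).differentiableAt, fun t => ?_⟩
  rw [(hderiv t).deriv, eq2 t, hconst, balance]
end

section
/- Consider the non-jacketed CSTR operating at constant concentration c(t) = c⁰ for all t, with 0 < c⁰ < 1. Let T : ℝ → ℝ be differentiable with T(t) > T_c ≥ 0 for all t, let ρ, F_c : ℝ → ℝ with 0 ≤ F_c(t) ≤ F_max for all t, and suppose both model equations hold for all t. Then ρ is differentiable and for every t, (N·ρ(t)/T(t)²)·((T_f - T(t))·ρ(t)/V + ρ(t)·(1 - c⁰)/V - α_c·(T(t) - T_c)·F_max) ≤ ρ'(t) ≤ (N·ρ(t)/T(t)²)·((T_f - T(t))·ρ(t)/V + ρ(t)·(1 - c⁰)/V). -/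
/-- Non-jacketed CSTR at constant concentration with bounded coolant flow
`0 ≤ F_c ≤ F_max`: the production rate is differentiable and its derivative obeys the
dynamic ramping limits `ν_min(ρ) ≤ ρ' ≤ ν_max(ρ)`. -/
theorem cstr1_dynamic_ramping_limits
    (V k N αc Tf Tc Fmax : ℝ) (hV : 0 < V) (hk : 0 < k) (hN : 0 < N) (hαc : 0 < αc)
    (hTc : 0 ≤ Tc)
    (c0 : ℝ) (hc0 : 0 < c0) (hc0' : c0 < 1)
    (c T ρ Fc : ℝ → ℝ)
    (hconst : ∀ t, c t = c0)
    (hT : Differentiable ℝ T) (hTgt : ∀ t, Tc < T t)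
    (hFc : ∀ t, 0 ≤ Fc t ∧ Fc t ≤ Fmax)
    (eq1 : ∀ t, deriv c t = (1 - c t) * ρ t / V - c t * k * Real.exp (-N / T t))
    (eq2 : ∀ t, deriv T t =
      (Tf - T t) * ρ t / V + c t * k * Real.exp (-N / T t) - Fc t * αc * (T t - Tc)) :
    Differentiable ℝ ρ ∧
      ∀ t,
        (N * ρ t / (T t) ^ 2) *
            ((Tf - T t) * ρ t / V + ρ t * (1 - c0) / V - αc * (T t - Tc) * Fmax)
          ≤ deriv ρ t ∧
        deriv ρ t ≤
          (N * ρ t / (T t) ^ 2) * ((Tf - T t) * ρ t / V + ρ t * (1 - c0) / V) := by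
  have hc1 : 0 < 1 - c0 := sub_pos.mpr hc0'
  have hTpos : ∀ t, 0 < T t := fun t => hTc.trans_lt (hTgt t)
  have hbalance : ∀ t, c0 * k * Real.exp (-N / T t) = ρ t * (1 - c0) / V := by
    intro t
    have h := eq1 t
    rw [show c = fun _ => c0 from funext hconst, deriv_const] at h
    linear_combination h
  have hρ : ρ = fun t => V * c0 * k / (1 - c0) * Real.exp (-N / T t) := by
    funext t
    have h := hbalance t
    field_simp at h ⊢
    linarith
  have hρpos : ∀ t, 0 < ρ t := by
    intro t
    rw [hρ]
    positivity
  have hderiv : ∀ t, HasDerivAt ρ (N * ρ t / (T t) ^ 2 * deriv T t) t := by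
    intro t
    have hTt := (hTpos t).ne'
    have h := (((hasDerivAt_const t (-N)).div (hT t).hasDerivAt hTt).exp).const_mul
      (V * c0 * k / (1 - c0))
    rw [hρ]
    refine h.congr_deriv ?_
    simp only [Pi.div_apply]
    ring
  refine ⟨fun t => (hderiv t).differentiableAt, fun t => ?_⟩
  have hgain : 0 ≤ N * ρ t / (T t) ^ 2 := by
    have := hρpos t
    positivity
  have hcool : 0 ≤ αc * (T t - Tc) := mul_nonneg hαc.le (sub_pos.mpr (hTgt t)).le
  have hlower := mul_le_mul_of_nonneg_left (hFc t).2 hcool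
  have hupper := mul_nonneg hcool (hFc t).1
  rw [(hderiv t).deriv, eq2 t, hconst t, hbalance t]
  constructor <;> refine mul_le_mul_of_nonneg_left ?_ hgain <;> linarith
end

section
/- Consider the non-jacketed CSTR operating at constant concentration c(t) = c⁰ for all t, with 0 < c⁰ < 1. Let T : ℝ → ℝ be differentiable with T(t) > 0 and T(t) ≠ T_c for all t, let ρ, F_c : ℝ → ℝ, and suppose both model equations hold for all t. Then for every t the coolant flow rate is determined by the production rate, its derivative and the temperature: F_c(t) = ((T_f - T(t))·ρ(t)/V + ρ(t)·(1 - c⁰)/V - ρ'(t)·T(t)²/(N·ρ(t))) / (α_c·(T(t) - T_c)). -/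
/-- Non-jacketed CSTR at constant concentration: the coolant flow rate (the nominal
feedforward-linearization input) is determined by the production rate, its derivative
and the temperature. -/
theorem cstr1_feedforward_input
    (V k N αc Tf Tc : ℝ) (hV : 0 < V) (hk : 0 < k) (hN : 0 < N) (hαc : 0 < αc)
    (c0 : ℝ) (hc0 : 0 < c0) (hc0' : c0 < 1)
    (c T ρ Fc : ℝ → ℝ)
    (hconst : ∀ t, c t = c0)
    (hT : Differentiable ℝ T) (hTpos : ∀ t, 0 < T t) (hTne : ∀ t, T t ≠ Tc)
    (eq1 : ∀ t, deriv c t = (1 - c t) * ρ t / V - c t * k * Real.exp (-N / T t))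
    (eq2 : ∀ t, deriv T t =
      (Tf - T t) * ρ t / V + c t * k * Real.exp (-N / T t) - Fc t * αc * (T t - Tc)) :
    ∀ t, Fc t =
      ((Tf - T t) * ρ t / V + ρ t * (1 - c0) / V - deriv ρ t * (T t) ^ 2 / (N * ρ t)) /
        (αc * (T t - Tc)) := by
  have hρ : ∀ t, (1 - c0) * ρ t / V = c0 * k * Real.exp (-N / T t) := by
    intro t
    have h := eq1 t
    rw [show c = fun _ => c0 from funext hconst, deriv_const] at h
    linarith
  have hc1 : 1 - c0 ≠ 0 := (sub_pos.2 hc0').ne'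
  have hρfun : ρ = fun t => c0 * k * V / (1 - c0) * Real.exp (-N / T t) := by
    funext t
    have h := hρ t
    field_simp at h ⊢
    linarith
  intro t
  have hTt : T t ≠ 0 := (hTpos t).ne'
  have hρt : ρ t ≠ 0 := by
    rw [hρfun]
    have := sub_pos.2 hc0'
    positivity
  have hderiv : deriv ρ t = ρ t * (N * deriv T t / T t ^ 2) := by
    have h := (((hasDerivAt_const t (-N)).div (hT t).hasDerivAt hTt).exp).const_mul
      (c0 * k * V / (1 - c0))
    rw [(h.congr_of_eventuallyEq (.of_eq hρfun)).deriv, congrFun hρfun t]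
    simp only [Pi.div_apply]
    ring
  have hT' : deriv ρ t * T t ^ 2 / (N * ρ t) = deriv T t := by
    rw [hderiv]
    field_simp
  have hden : αc * (T t - Tc) ≠ 0 := mul_ne_zero hαc.ne' (sub_ne_zero.2 (hTne t))
  rw [hT', eq_div_iff hden, eq2 t, hconst t, ← hρ t]
  ring
end

section
/- Consider the non-jacketed CSTR operating at constant concentration c(t) = c⁰ for all t, with 0 < c⁰ < 1. Let T : ℝ → ℝ be differentiable with T(t) > 0 for all t, let ρ, F_c : ℝ → ℝ, and suppose both model equations hold for all t. Then the instantaneous waste heat Q_wh(t) := F_c(t)·α_c·(T(t) - T_c) satisfies, for every t, Q_wh(t) = (T_f - T(t))·ρ(t)/V + ρ(t)·(1 - c⁰)/V - ρ'(t)·T(t)²/(N·ρ(t)). -/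
/-- Non-jacketed CSTR at constant concentration: the instantaneous waste heat
`Q_wh = F_c·α_c·(T - T_c)` is an exact nonlinear function of the production rate and
its time derivative. -/
theorem cstr1_waste_heat_model
    (V k N αc Tf Tc : ℝ) (hV : 0 < V) (hk : 0 < k) (hN : 0 < N) (hαc : 0 < αc)
    (c0 : ℝ) (hc0 : 0 < c0) (hc0' : c0 < 1)
    (c T ρ Fc : ℝ → ℝ)
    (hconst : ∀ t, c t = c0)
    (hT : Differentiable ℝ T) (hTpos : ∀ t, 0 < T t)
    (eq1 : ∀ t, deriv c t = (1 - c t) * ρ t / V - c t * k * Real.exp (-N / T t))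
    (eq2 : ∀ t, deriv T t =
      (Tf - T t) * ρ t / V + c t * k * Real.exp (-N / T t) - Fc t * αc * (T t - Tc)) :
    ∀ t, Fc t * αc * (T t - Tc) =
      (Tf - T t) * ρ t / V + ρ t * (1 - c0) / V - deriv ρ t * (T t) ^ 2 / (N * ρ t) := by
  have hc : c = fun _ => c0 := funext hconst
  subst hc
  have h1c : 1 - c0 ≠ 0 := (sub_pos.mpr hc0').ne'
  have balance : ∀ t, ρ t * (1 - c0) / V = c0 * k * Real.exp (-N / T t) := by
    intro t
    have h := eq1 t
    rw [deriv_const] at h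
    linear_combination -h
  have hρ : ρ = fun t => V * c0 * k / (1 - c0) * Real.exp (-N / T t) := by
    funext t
    have h := balance t
    field_simp at h ⊢
    linear_combination h
  intro t
  have hTt : T t ≠ 0 := (hTpos t).ne'
  have hρ_ne : ρ t ≠ 0 := by
    rw [hρ]
    have := sub_pos.mpr hc0'
    positivity
  have hρ_deriv : deriv ρ t = ρ t * (N * deriv T t / T t ^ 2) := by
    have h := ((((hasDerivAt_const t (-N)).div (hT t).hasDerivAt hTt).exp).const_mul
      (V * c0 * k / (1 - c0))).deriv
    simp only [Pi.div_apply] at h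
    rw [hρ]
    refine Eq.trans h ?_
    ring
  have hT_deriv : deriv ρ t * T t ^ 2 / (N * ρ t) = deriv T t := by
    rw [hρ_deriv]
    field_simp
  rw [hT_deriv, balance t]
  linear_combination eq2 t
end

section
/- Consider the jacketed CSTR operating at constant concentration c(t) = c⁰ for all t, with 0 < c⁰ < 1. Let T : ℝ → ℝ be differentiable with T(t) > 0 for all t, let T_j, ρ : ℝ → ℝ, and suppose the concentration equation c' = (1 - c)·ρ/V - c·k·exp(-N/T) and the reactor temperature equation T' = (T_f - T)·ρ/V + c·k·exp(-N/T) + τ₁·(T_j - T) hold for all t. Then ρ(t) = V·c⁰·k·exp(-N/T(t))/(1 - c⁰), ρ is differentiable with ρ'(t) = N·ρ(t)·T'(t)/T(t)², and the jacket temperature is determined by ρ and ρ': T_j(t) = T(t) + (1/τ₁)·(ρ'(t)·T(t)²/(N·ρ(t)) - (T_f - T(t))·ρ(t)/V - ρ(t)·(1 - c⁰)/V) for every t. -/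
/-- Jacketed CSTR at constant concentration: the state transformation `x = Γ(φ)`. The
production rate is determined by the temperature, is differentiable with
`ρ' = N·ρ·T'/T²`, and the jacket temperature is determined by `ρ` and `ρ'`. -/
theorem cstr2_state_transformation
    (V k N αc τ1 τ2 Tf Tc : ℝ) (hV : 0 < V) (hk : 0 < k) (hN : 0 < N) (hαc : 0 < αc)
    (hτ1 : 0 < τ1) (hτ2 : 0 < τ2)
    (c0 : ℝ) (hc0 : 0 < c0) (hc0' : c0 < 1)
    (c T Tj ρ : ℝ → ℝ)
    (hconst : ∀ t, c t = c0)
    (hT : Differentiable ℝ T) (hTpos : ∀ t, 0 < T t)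
    (eq1 : ∀ t, deriv c t = (1 - c t) * ρ t / V - c t * k * Real.exp (-N / T t))
    (eq2 : ∀ t, deriv T t =
      (Tf - T t) * ρ t / V + c t * k * Real.exp (-N / T t) + τ1 * (Tj t - T t)) :
    (∀ t, ρ t = V * c0 * k * Real.exp (-N / T t) / (1 - c0)) ∧
      Differentiable ℝ ρ ∧
      (∀ t, deriv ρ t = N * ρ t * deriv T t / (T t) ^ 2) ∧
      ∀ t, Tj t = T t + (1 / τ1) *
        (deriv ρ t * (T t) ^ 2 / (N * ρ t) - (Tf - T t) * ρ t / V - ρ t * (1 - c0) / V) := by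
  have h1c : 0 < 1 - c0 := sub_pos.mpr hc0'
  have balance : ∀ t, c0 * k * Real.exp (-N / T t) = (1 - c0) * ρ t / V := by
    intro t
    have hc : c = fun _ => c0 := funext hconst
    have h := eq1 t
    rw [hc, deriv_const] at h
    linarith
  have hρ : ∀ t, ρ t = V * c0 * k * Real.exp (-N / T t) / (1 - c0) := by
    intro t
    have h := balance t
    rw [eq_div_iff hV.ne'] at h
    rw [eq_div_iff h1c.ne']
    linarith
  have hρpos : ∀ t, 0 < ρ t := by
    intro t
    rw [hρ t]
    positivity
  have hderiv : ∀ t, HasDerivAt ρ (N * ρ t * deriv T t / (T t) ^ 2) t := by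
    intro t
    have hexp := (((hasDerivAt_const t (-N)).div (hT t).hasDerivAt (hTpos t).ne').exp.const_mul
      (V * c0 * k)).div_const (1 - c0)
    rw [funext hρ]
    refine hexp.congr_deriv ?_
    simp only [Pi.div_apply]
    ring
  refine ⟨hρ, fun t => (hderiv t).differentiableAt, fun t => (hderiv t).deriv, fun t => ?_⟩
  have hTne := (hTpos t).ne'
  have hρne := (hρpos t).ne'
  have hratio : deriv ρ t * (T t) ^ 2 / (N * ρ t) = deriv T t := by
    rw [(hderiv t).deriv]
    field_simp
  rw [hratio, eq2 t, hconst t, balance t]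
  field_simp
  ring
end

section
/- Consider the jacketed CSTR operating at constant concentration c(t) = c⁰ for all t, with 0 < c⁰ < 1. Let T, T_j : ℝ → ℝ be differentiable with T(t) > 0 for all t, let ρ, F_c : ℝ → ℝ, and suppose all three model equations hold for all t. Then T is twice differentiable, ρ is twice differentiable, and for every t, ρ''(t) = N·ρ'(t)·T'(t)/T(t)² - 2·N·ρ(t)·T'(t)²/T(t)³ + (N·ρ(t)/T(t)²)·( -ρ(t)·T'(t)/V + (T_f - T(t))·ρ'(t)/V + ρ(t)·(1 - c⁰)·N·T'(t)/(V·T(t)²) + τ₁·(τ₂·(T(t) - T_j(t)) - F_c(t)·α_c·(T_j(t) - T_c)) - τ₁·T'(t) ). -/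
/-- A multiple of the Arrhenius factor `exp (-N / T)` has logarithmic derivative `N * T' / T ^ 2`. -/
theorem hasDerivAt_mul_exp_neg_div {A N T' t : ℝ} {T : ℝ → ℝ} (hT : HasDerivAt T T' t)
    (h0 : T t ≠ 0) :
    HasDerivAt (fun s => A * Real.exp (-N / T s))
      (A * Real.exp (-N / T t) * (N * T' / T t ^ 2)) t := by
  have h := (((hasDerivAt_const t (-N)).div hT h0).exp).const_mul A
  refine h.congr_deriv ?_
  simp only [Pi.div_apply]
  ring

/-- Jacketed CSTR at constant concentration: the temperature and the production rate are
twice differentiable and `ρ''` is given by the stated affine function of the coolant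
flow rate `F_c`. -/
theorem cstr2_second_order_ramping
    (V k N αc τ1 τ2 Tf Tc : ℝ) (hV : 0 < V) (hk : 0 < k) (hN : 0 < N) (hαc : 0 < αc)
    (hτ1 : 0 < τ1) (hτ2 : 0 < τ2)
    (c0 : ℝ) (hc0 : 0 < c0) (hc0' : c0 < 1)
    (c T Tj ρ Fc : ℝ → ℝ)
    (hconst : ∀ t, c t = c0)
    (hT : Differentiable ℝ T) (hTj : Differentiable ℝ Tj) (hTpos : ∀ t, 0 < T t)
    (eq1 : ∀ t, deriv c t = (1 - c t) * ρ t / V - c t * k * Real.exp (-N / T t))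
    (eq2 : ∀ t, deriv T t =
      (Tf - T t) * ρ t / V + c t * k * Real.exp (-N / T t) + τ1 * (Tj t - T t))
    (eq3 : ∀ t, deriv Tj t = τ2 * (T t - Tj t) - Fc t * αc * (Tj t - Tc)) :
    Differentiable ℝ (deriv T) ∧
      Differentiable ℝ ρ ∧ Differentiable ℝ (deriv ρ) ∧
      ∀ t, deriv (deriv ρ) t =
        N * deriv ρ t * deriv T t / (T t) ^ 2
          - 2 * N * ρ t * (deriv T t) ^ 2 / (T t) ^ 3
          + (N * ρ t / (T t) ^ 2) *
            (-(ρ t) * deriv T t / V + (Tf - T t) * deriv ρ t / V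
              + ρ t * (1 - c0) * N * deriv T t / (V * (T t) ^ 2)
              + τ1 * (τ2 * (T t - Tj t) - Fc t * αc * (Tj t - Tc))
              - τ1 * deriv T t) := by
  have h1c : 1 - c0 ≠ 0 := (sub_pos.2 hc0').ne'
  have hV0 : V ≠ 0 := hV.ne'
  have hρ : ρ = fun t => V * c0 * k / (1 - c0) * Real.exp (-N / T t) := by
    funext t
    have h := eq1 t
    rw [funext hconst, deriv_const] at h
    field_simp at h ⊢
    linarith
  have hρd (t : ℝ) : HasDerivAt ρ (ρ t * (N * deriv T t / T t ^ 2)) t := by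
    rw [hρ]
    exact hasDerivAt_mul_exp_neg_div (hT t).hasDerivAt (hTpos t).ne'
  have hρ' : deriv ρ = fun t => ρ t * (N * deriv T t / T t ^ 2) :=
    funext fun t => (hρd t).deriv
  have hT' : deriv T =
      fun t => (Tf - T t) * ρ t / V + (1 - c0) * ρ t / V + τ1 * (Tj t - T t) := by
    funext t
    have h := eq1 t
    rw [funext hconst, deriv_const] at h
    rw [eq2 t, hconst t]
    linarith
  have hT'd (t : ℝ) : HasDerivAt (deriv T)
      ((-deriv T t * ρ t + (Tf - T t) * deriv ρ t) / V + (1 - c0) * deriv ρ t / V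
        + τ1 * (deriv Tj t - deriv T t)) t := by
    have hTt := (hT t).hasDerivAt
    have hρt := (hρd t).differentiableAt.hasDerivAt
    have h := ((((hTt.const_sub Tf).mul hρt).div_const V).add
      ((hρt.const_mul (1 - c0)).div_const V)).add
      (((hTj t).hasDerivAt.sub hTt).const_mul τ1)
    exact h.congr_of_eventuallyEq (Filter.Eventually.of_forall (congrFun hT'))
  have hρ'd (t : ℝ) := (hρd t).mul
    (((hT'd t).const_mul N).div ((hT t).hasDerivAt.pow 2) (pow_ne_zero 2 (hTpos t).ne'))
  have hρ'd' (t : ℝ) := (hρ'd t).congr_of_eventuallyEq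
    (Filter.Eventually.of_forall (congrFun hρ'))
  refine ⟨fun t => (hT'd t).differentiableAt, fun t => (hρd t).differentiableAt,
    fun t => (hρ'd' t).differentiableAt, fun t => ?_⟩
  have hTt := (hTpos t).ne'
  rw [(hρ'd' t).deriv, eq3 t, (hρd t).deriv]
  simp only [Pi.pow_apply, Pi.div_apply]
  generalize deriv T t = D
  field_simp
  ring
end

section
/- Fix real numbers ρ, ρ̇, T_f and positive constants V, k, N, τ₁. Define Ψ : ℝ³ → ℝ³ by Ψ(c, T, T_j) = (c, α₁(c, T), α₂(c, T, T_j)) where α₁(c, T) = (1 - c)·ρ/V - c·k·exp(-N/T) and α₂(c, T, T_j) = -(ρ/V + k·exp(-N/T))·((1 - c)·ρ/V - c·k·exp(-N/T)) - (c·k·N·exp(-N/T)/T²)·((T_f - T)·ρ/V + c·k·exp(-N/T) + τ₁·(T_j - T)) + ((1 - c)/V)·ρ̇. Then for every (c, T, T_j) with T ≠ 0, Ψ is differentiable at (c, T, T_j) and the determinant of its Fréchet derivative equals N²·τ₁·c²·k²·exp(-2·N/T)/T⁴; in particular, the derivative is a linear isomorphism whenever c ≠ 0. -/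
/-- Coordinates identifying `ℝ × ℝ × ℝ` with `Fin 3 → ℝ`. -/
def tripleEquivFun : (ℝ × ℝ × ℝ) ≃ₗ[ℝ] (Fin 3 → ℝ) where
  toFun p := ![p.1, p.2.1, p.2.2]
  invFun v := (v 0, v 1, v 2)
  map_add' p q := by ext i; fin_cases i <;> simp
  map_smul' r p := by ext i; fin_cases i <;> simp
  left_inv p := by simp
  right_inv v := by ext i; fin_cases i <;> simp

/-- An endomorphism of `ℝ × ℝ × ℝ` whose matrix in the standard basis is lower triangular
has determinant the product of its diagonal entries. -/
theorem det_eq_of_lowerTriangular (L : (ℝ × ℝ × ℝ) →ₗ[ℝ] (ℝ × ℝ × ℝ)) {d₁ d₂ d₃ : ℝ}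
    (h₁ : (L (1, 0, 0)).1 = d₁) (h₂ : (L (0, 1, 0)).1 = 0) (h₃ : (L (0, 0, 1)).1 = 0)
    (h₂₂ : (L (0, 1, 0)).2.1 = d₂) (h₂₃ : (L (0, 0, 1)).2.1 = 0)
    (h₃₃ : (L (0, 0, 1)).2.2 = d₃) :
    LinearMap.det L = d₁ * d₂ * d₃ := by
  rw [← LinearMap.det_toMatrix (Module.Basis.ofEquivFun tripleEquivFun), Matrix.det_fin_three]
  simp [LinearMap.toMatrix_apply, tripleEquivFun, h₁, h₂, h₃, h₂₂, h₂₃, h₃₃]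

/-- The Jacobian determinant of `(c, T, S) ↦ (c, g(c,T), h(c,T,S))` is `∂g/∂T * ∂h/∂S`. -/
theorem det_fderiv_of_triangular {g : ℝ × ℝ → ℝ} {h : ℝ × ℝ × ℝ → ℝ} {c T S a b : ℝ}
    (hd : DifferentiableAt ℝ (fun p : ℝ × ℝ × ℝ => (p.1, g (p.1, p.2.1), h p)) (c, T, S))
    (hg : HasDerivAt (fun t => g (c, t)) a T) (hh : HasDerivAt (fun s => h (c, T, s)) b S) :
    LinearMap.det
      (fderiv ℝ (fun p : ℝ × ℝ × ℝ => (p.1, g (p.1, p.2.1), h p)) (c, T, S)).toLinearMap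
      = a * b := by
  have hF := hd.hasFDerivAt
  set L := fderiv ℝ (fun p : ℝ × ℝ × ℝ => (p.1, g (p.1, p.2.1), h p)) (c, T, S)
  have hfst (v : ℝ × ℝ × ℝ) : (L v).1 = v.1 :=
    congrArg (fun M : ℝ × ℝ × ℝ →L[ℝ] ℝ => M v) (hF.fst.unique hasFDerivAt_fst)
  have hlineT : HasDerivAt (fun t : ℝ => (c, t, S)) (0, 1, 0) T :=
    (hasDerivAt_const T c).prodMk ((hasDerivAt_id T).prodMk (hasDerivAt_const T S))
  have hlineS : HasDerivAt (fun s : ℝ => (c, T, s)) (0, 0, 1) S :=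
    (hasDerivAt_const S c).prodMk ((hasDerivAt_const S T).prodMk (hasDerivAt_id S))
  have hgT := hF.snd.fst.comp_hasDerivAt T hlineT
  have hgS := hF.snd.fst.comp_hasDerivAt S hlineS
  have hhS := hF.snd.snd.comp_hasDerivAt S hlineS
  have key := det_eq_of_lowerTriangular L.toLinearMap (hfst _) (hfst _) (hfst _)
    (hgT.unique hg) (hgS.unique (hasDerivAt_const S (g (c, T)))) (hhS.unique hh)
  simpa using key


/-- The map `Ψ(c,T,T_j) = (α₀, α₁, α₂)` of the jacketed CSTR is differentiable away
from `T = 0`, its Fréchet derivative has determinant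
`N²·τ₁·c²·k²·exp(-2N/T)/T⁴`, and the derivative is a linear isomorphism whenever
`c ≠ 0`. -/
theorem cstr2_jacobian_determinant
    (ρ ρdot Tf V k N τ1 : ℝ) (hV : 0 < V) (hk : 0 < k) (hN : 0 < N) (hτ1 : 0 < τ1) :
    ∀ c T Tj : ℝ, T ≠ 0 →
      DifferentiableAt ℝ
        (fun p : ℝ × ℝ × ℝ =>
          (p.1,
            (1 - p.1) * ρ / V - p.1 * k * Real.exp (-N / p.2.1),
            -(ρ / V + k * Real.exp (-N / p.2.1)) *
                ((1 - p.1) * ρ / V - p.1 * k * Real.exp (-N / p.2.1))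
              - (p.1 * k * N * Real.exp (-N / p.2.1) / p.2.1 ^ 2) *
                ((Tf - p.2.1) * ρ / V + p.1 * k * Real.exp (-N / p.2.1)
                  + τ1 * (p.2.2 - p.2.1))
              + ((1 - p.1) / V) * ρdot)) (c, T, Tj) ∧
      LinearMap.det
        ((fderiv ℝ
          (fun p : ℝ × ℝ × ℝ =>
            (p.1,
              (1 - p.1) * ρ / V - p.1 * k * Real.exp (-N / p.2.1),
              -(ρ / V + k * Real.exp (-N / p.2.1)) *
                  ((1 - p.1) * ρ / V - p.1 * k * Real.exp (-N / p.2.1))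
                - (p.1 * k * N * Real.exp (-N / p.2.1) / p.2.1 ^ 2) *
                  ((Tf - p.2.1) * ρ / V + p.1 * k * Real.exp (-N / p.2.1)
                    + τ1 * (p.2.2 - p.2.1))
                + ((1 - p.1) / V) * ρdot)) (c, T, Tj)).toLinearMap)
        = N ^ 2 * τ1 * c ^ 2 * k ^ 2 * Real.exp (-2 * N / T) / T ^ 4 ∧
      (c ≠ 0 → Function.Bijective
        (fderiv ℝ
          (fun p : ℝ × ℝ × ℝ =>
            (p.1,
              (1 - p.1) * ρ / V - p.1 * k * Real.exp (-N / p.2.1),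
              -(ρ / V + k * Real.exp (-N / p.2.1)) *
                  ((1 - p.1) * ρ / V - p.1 * k * Real.exp (-N / p.2.1))
                - (p.1 * k * N * Real.exp (-N / p.2.1) / p.2.1 ^ 2) *
                  ((Tf - p.2.1) * ρ / V + p.1 * k * Real.exp (-N / p.2.1)
                    + τ1 * (p.2.2 - p.2.1))
                + ((1 - p.1) / V) * ρdot)) (c, T, Tj))) := by
  intro c T Tj hT
  have and_of_imp {p q : Prop} (hp : p) (hq : p → q) : p ∧ q := ⟨hp, hq hp⟩
  refine and_of_imp ?_ fun hd => and_of_imp ?_ fun hdet hc => ?_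
  · fun_prop (disch := simpa using hT)
  · have hα₁ : HasDerivAt (fun t => (1 - c) * ρ / V - c * k * Real.exp (-N / t))
        (-(c * k * (Real.exp (-N / T) * (N / T ^ 2)))) T := by
      have hq : HasDerivAt (fun t : ℝ => -N / t) (N / T ^ 2) T := by
        simpa using (hasDerivAt_const T (-N)).fun_div (hasDerivAt_id' T) hT
      exact (hq.exp.const_mul (c * k)).const_sub _
    have hα₂ : HasDerivAt (fun s =>
        -(ρ / V + k * Real.exp (-N / T)) * ((1 - c) * ρ / V - c * k * Real.exp (-N / T))
          - (c * k * N * Real.exp (-N / T) / T ^ 2) *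
            ((Tf - T) * ρ / V + c * k * Real.exp (-N / T) + τ1 * (s - T))
          + ((1 - c) / V) * ρdot)
        (-((c * k * N * Real.exp (-N / T) / T ^ 2) * (τ1 * 1))) Tj :=
      ((((((hasDerivAt_id Tj).sub_const T).const_mul τ1).const_add _).const_mul _).const_sub
        _).add_const _
    have hexp : Real.exp (-2 * N / T) = Real.exp (-N / T) ^ 2 := by
      rw [← Real.exp_nat_mul]
      congr 1
      push_cast
      ring
    refine (det_fderiv_of_triangular
      (g := fun q => (1 - q.1) * ρ / V - q.1 * k * Real.exp (-N / q.2)) hd hα₁ hα₂).trans ?_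
    rw [hexp]
    field_simp
  · have hne : N ^ 2 * τ1 * c ^ 2 * k ^ 2 * Real.exp (-2 * N / T) / T ^ 4 ≠ 0 := by positivity
    rw [← hdet] at hne
    exact (Module.End.isUnit_iff _).1
      ((LinearMap.isUnit_iff_isUnit_det _).2 (isUnit_iff_ne_zero.2 hne))
end

section
/- Consider the jacketed CSTR operating at constant concentration c(t) = c⁰ for all t, with 0 < c⁰ < 1. Let T, T_j : ℝ → ℝ be differentiable with T(t) > 0 and T_j(t) > T_c ≥ 0 for all t, let ρ, F_c : ℝ → ℝ with 0 ≤ F_c(t) ≤ F_max for all t, and suppose all three model equations hold for all t. Define B(t) := N·ρ'(t)·T'(t)/T(t)² - 2·N·ρ(t)·T'(t)²/T(t)³ + (N·ρ(t)/T(t)²)·( -ρ(t)·T'(t)/V + (T_f - T(t))·ρ'(t)/V + ρ(t)·(1 - c⁰)·N·T'(t)/(V·T(t)²) + τ₁·τ₂·(T(t) - T_j(t)) - τ₁·T'(t) ). Then ρ is twice differentiable and for every t, B(t) - (N·ρ(t)·τ₁·α_c·(T_j(t) - T_c)/T(t)²)·F_max ≤ ρ''(t) ≤ B(t). -/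
/-- Jacketed CSTR at constant concentration with bounded coolant flow
`0 ≤ F_c ≤ F_max`: the production rate is twice differentiable and `ρ''` obeys the
second-order dynamic ramping limits, attained at maximum and zero coolant flow. -/
theorem cstr2_dynamic_ramping_limits
    (V k N αc τ1 τ2 Tf Tc Fmax : ℝ) (hV : 0 < V) (hk : 0 < k) (hN : 0 < N) (hαc : 0 < αc)
    (hτ1 : 0 < τ1) (hτ2 : 0 < τ2) (hTc : 0 ≤ Tc)
    (c0 : ℝ) (hc0 : 0 < c0) (hc0' : c0 < 1)
    (c T Tj ρ Fc : ℝ → ℝ)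
    (hconst : ∀ t, c t = c0)
    (hT : Differentiable ℝ T) (hTj : Differentiable ℝ Tj)
    (hTpos : ∀ t, 0 < T t) (hTjgt : ∀ t, Tc < Tj t)
    (hFc : ∀ t, 0 ≤ Fc t ∧ Fc t ≤ Fmax)
    (eq1 : ∀ t, deriv c t = (1 - c t) * ρ t / V - c t * k * Real.exp (-N / T t))
    (eq2 : ∀ t, deriv T t =
      (Tf - T t) * ρ t / V + c t * k * Real.exp (-N / T t) + τ1 * (Tj t - T t))
    (eq3 : ∀ t, deriv Tj t = τ2 * (T t - Tj t) - Fc t * αc * (Tj t - Tc))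
    (B : ℝ → ℝ)
    (hB : ∀ t, B t =
      N * deriv ρ t * deriv T t / (T t) ^ 2
        - 2 * N * ρ t * (deriv T t) ^ 2 / (T t) ^ 3
        + (N * ρ t / (T t) ^ 2) *
          (-(ρ t) * deriv T t / V + (Tf - T t) * deriv ρ t / V
            + ρ t * (1 - c0) * N * deriv T t / (V * (T t) ^ 2)
            + τ1 * τ2 * (T t - Tj t)
            - τ1 * deriv T t)) :
    Differentiable ℝ ρ ∧ Differentiable ℝ (deriv ρ) ∧
      ∀ t,
        B t - (N * ρ t * τ1 * αc * (Tj t - Tc) / (T t) ^ 2) * Fmax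
          ≤ deriv (deriv ρ) t ∧
        deriv (deriv ρ) t ≤ B t := by
  have h1c : (0 : ℝ) < 1 - c0 := sub_pos.mpr hc0'
  have hreact : ∀ t, c0 * k * Real.exp (-N / T t) = (1 - c0) * ρ t / V := fun t ↦ by
    have h := eq1 t
    rw [funext hconst, deriv_const] at h
    linarith
  have hρ_eq : ρ = fun t ↦ V * c0 * k / (1 - c0) * Real.exp (-N / T t) := by
    funext t
    have h := hreact t
    field_simp at h ⊢
    linarith
  have hρ_pos : ∀ t, 0 < ρ t := fun t ↦ by
    rw [hρ_eq]
    positivity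
  have hdT : ∀ t, HasDerivAt T (deriv T t) t := fun t ↦ (hT t).hasDerivAt
  have hdρ : ∀ t, HasDerivAt ρ (N * ρ t * deriv T t / T t ^ 2) t := fun t ↦ by
    have hT0 := (hTpos t).ne'
    have h := ((((hasDerivAt_const t (-N)).div (hdT t) hT0).exp).const_mul
      (V * c0 * k / (1 - c0)))
    rw [hρ_eq]
    refine h.congr_deriv ?_
    simp only [Pi.div_apply]
    ring
  have hρ' : deriv ρ = fun t ↦ N * ρ t * deriv T t / T t ^ 2 := funext fun t ↦ (hdρ t).deriv
  have hT' : deriv T = fun t ↦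
      (Tf - T t) * ρ t / V + (1 - c0) * ρ t / V + τ1 * (Tj t - T t) := by
    funext t
    rw [eq2 t, hconst t, hreact t]
  have hddT : ∀ t, HasDerivAt (deriv T)
      (-deriv T t * ρ t / V + (Tf - T t) * deriv ρ t / V + (1 - c0) * deriv ρ t / V
        + τ1 * (deriv Tj t - deriv T t)) t := fun t ↦ by
    have hr := (hdρ t).differentiableAt.hasDerivAt
    have h := ((((hdT t).const_sub Tf).mul hr).div_const V).add
      ((hr.const_mul (1 - c0)).div_const V) |>.add
      (((hTj t).hasDerivAt.sub (hdT t)).const_mul τ1)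
    have h' := h.congr_of_eventuallyEq (f₁ := deriv T) (.of_forall fun s ↦ by
      rw [hT']; simp)
    refine h'.congr_deriv ?_
    ring
  have hddρ : ∀ t, HasDerivAt (deriv ρ)
      (B t - (N * ρ t * τ1 * αc * (Tj t - Tc) / T t ^ 2) * Fc t) t := fun t ↦ by
    have hT0 := (hTpos t).ne'
    have h := (((hdρ t).const_mul N).mul (hddT t)).div ((hdT t).pow 2) (pow_ne_zero 2 hT0)
    have h' := h.congr_of_eventuallyEq (f₁ := deriv ρ) (.of_forall fun s ↦ by
      rw [hρ']; simp)
    refine h'.congr_deriv ?_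
    rw [hB t, eq3 t, (hdρ t).deriv]
    simp only [Pi.mul_apply, Pi.pow_apply]
    field_simp
    ring
  refine ⟨fun t ↦ (hdρ t).differentiableAt, fun t ↦ (hddρ t).differentiableAt, fun t ↦ ?_⟩
  have hcoef : 0 ≤ N * ρ t * τ1 * αc * (Tj t - Tc) / T t ^ 2 := by
    have := hρ_pos t
    have := sub_pos.mpr (hTjgt t)
    positivity
  rw [(hddρ t).deriv]
  exact ⟨sub_le_sub_left (mul_le_mul_of_nonneg_left (hFc t).2 hcoef) _,
    sub_le_self _ (mul_nonneg hcoef (hFc t).1)⟩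
end
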